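/- Let g_1, …, g_K be pairwise commuting Hermitian signed Pauli strings on N qubits that are independent (the product over any nonempty subset is neither I nor −I), and let ρ = 2^{−(N−K)} ∏_{k=1}^K (I + g_k)/2 be the associated mixed stabiliser state. Then there exists a unitary U on ℂ^{2^N} such that U g U* is a signed Pauli string for every Pauli string g on N qubits, and U ρ U* = ((I₂ + X)/2)^{⊗K} ⊗ (I₂/2)^{⊗(N−K)}. -/

import Mathlib

open Matrix
open scoped Kronecker

/-- The Pauli matrix `X`. -/
noncomputable def PauliX : Matrix (Fin 2) (Fin 2) ℂ := !![0, 1; 1, 0]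

/-- The Pauli matrix `Y`. -/
noncomputable def PauliY : Matrix (Fin 2) (Fin 2) ℂ := !![0, -Complex.I; Complex.I, 0]

/-- The Pauli matrix `Z`. -/
noncomputable def PauliZ : Matrix (Fin 2) (Fin 2) ℂ := !![1, 0; 0, -1]

/-- The Pauli string `σ 1 ⊗ ⋯ ⊗ σ N`, realised as a matrix indexed by
`Fin N → Fin 2` (the `N`-fold tensor product of `ℂ²`). -/
noncomputable def PString {N : ℕ} (σ : Fin N → Matrix (Fin 2) (Fin 2) ℂ) :
    Matrix (Fin N → Fin 2) (Fin N → Fin 2) ℂ :=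
  Matrix.of fun a b => ∏ i, σ i (a i) (b i)

/-- A signed Pauli string on `N` qubits: `±(σ 1 ⊗ ⋯ ⊗ σ N)` with each `σ i` a Pauli
matrix or the identity. -/
def IsSignedPauli {N : ℕ} (M : Matrix (Fin N → Fin 2) (Fin N → Fin 2) ℂ) : Prop :=
  ∃ (s : ℂ) (σ : Fin N → Matrix (Fin 2) (Fin 2) ℂ),
    (s = 1 ∨ s = -1) ∧
    (∀ i, σ i ∈ ({1, PauliX, PauliY, PauliZ} : Set (Matrix (Fin 2) (Fin 2) ℂ))) ∧
    M = s • PString σ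

/-- The four single-qubit Pauli matrices, including the identity. -/
abbrev PauliSet : Set (Matrix (Fin 2) (Fin 2) ℂ) := {1, PauliX, PauliY, PauliZ}

section SingleQubit

variable {A B : Matrix (Fin 2) (Fin 2) ℂ}

lemma PauliX_conjTranspose : PauliXᴴ = PauliX := by
  ext i j; fin_cases i <;> fin_cases j <;> simp [PauliX]

lemma PauliY_conjTranspose : PauliYᴴ = PauliY := by
  ext i j; fin_cases i <;> fin_cases j <;> simp [PauliY]

lemma PauliZ_conjTranspose : PauliZᴴ = PauliZ := by
  ext i j; fin_cases i <;> fin_cases j <;> simp [PauliZ]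

lemma PauliX_mul_self : PauliX * PauliX = 1 := by
  ext i j; fin_cases i <;> fin_cases j <;> simp [PauliX]

lemma PauliY_mul_self : PauliY * PauliY = 1 := by
  ext i j; fin_cases i <;> fin_cases j <;> simp [PauliY]

lemma PauliZ_mul_self : PauliZ * PauliZ = 1 := by
  ext i j; fin_cases i <;> fin_cases j <;> simp [PauliZ]

lemma PauliX_mul_PauliY : PauliX * PauliY = Complex.I • PauliZ := by
  ext i j; fin_cases i <;> fin_cases j <;> simp [PauliX, PauliY, PauliZ]

lemma PauliY_mul_PauliX : PauliY * PauliX = (-Complex.I) • PauliZ := by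
  ext i j; fin_cases i <;> fin_cases j <;> simp [PauliX, PauliY, PauliZ]

lemma PauliY_mul_PauliZ : PauliY * PauliZ = Complex.I • PauliX := by
  ext i j; fin_cases i <;> fin_cases j <;> simp [PauliX, PauliY, PauliZ]

lemma PauliZ_mul_PauliY : PauliZ * PauliY = (-Complex.I) • PauliX := by
  ext i j; fin_cases i <;> fin_cases j <;> simp [PauliX, PauliY, PauliZ]

lemma PauliZ_mul_PauliX : PauliZ * PauliX = Complex.I • PauliY := by
  ext i j; fin_cases i <;> fin_cases j <;> simp [PauliX, PauliY, PauliZ]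

lemma PauliX_mul_PauliZ : PauliX * PauliZ = (-Complex.I) • PauliY := by
  ext i j; fin_cases i <;> fin_cases j <;> simp [PauliX, PauliY, PauliZ]

lemma PauliSet.conjTranspose_eq (hA : A ∈ PauliSet) : Aᴴ = A := by
  rcases hA with rfl | rfl | rfl | rfl
  exacts [conjTranspose_one, PauliX_conjTranspose, PauliY_conjTranspose, PauliZ_conjTranspose]

lemma PauliSet.mul_self (hA : A ∈ PauliSet) : A * A = 1 := by
  rcases hA with rfl | rfl | rfl | rfl
  exacts [one_mul 1, PauliX_mul_self, PauliY_mul_self, PauliZ_mul_self]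

lemma PauliSet.exists_mul_eq_smul (hA : A ∈ PauliSet) (hB : B ∈ PauliSet) :
    ∃ c : ℂ, ∃ C ∈ PauliSet, A * B = c • C := by
  rcases hA with rfl | rfl | rfl | rfl <;> rcases hB with rfl | rfl | rfl | rfl
  · exact ⟨1, 1, by simp, by simp⟩
  · exact ⟨1, PauliX, by simp, by simp⟩
  · exact ⟨1, PauliY, by simp, by simp⟩
  · exact ⟨1, PauliZ, by simp, by simp⟩
  · exact ⟨1, PauliX, by simp, by simp⟩
  · exact ⟨1, 1, by simp, by simp [PauliX_mul_self]⟩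
  · exact ⟨_, PauliZ, by simp, PauliX_mul_PauliY⟩
  · exact ⟨_, PauliY, by simp, PauliX_mul_PauliZ⟩
  · exact ⟨1, PauliY, by simp, by simp⟩
  · exact ⟨_, PauliZ, by simp, PauliY_mul_PauliX⟩
  · exact ⟨1, 1, by simp, by simp [PauliY_mul_self]⟩
  · exact ⟨_, PauliX, by simp, PauliY_mul_PauliZ⟩
  · exact ⟨1, PauliZ, by simp, by simp⟩
  · exact ⟨_, PauliY, by simp, PauliZ_mul_PauliX⟩
  · exact ⟨_, PauliX, by simp, PauliZ_mul_PauliY⟩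
  · exact ⟨1, 1, by simp, by simp [PauliZ_mul_self]⟩

lemma PauliSet.commute_or_anticommute (hA : A ∈ PauliSet) (hB : B ∈ PauliSet) :
    ∃ c : ℂ, (c = 1 ∨ c = -1) ∧ A * B = c • (B * A) := by
  rcases hA with rfl | rfl | rfl | rfl <;> rcases hB with rfl | rfl | rfl | rfl <;>
  first
  | refine ⟨1, Or.inl rfl, ?_⟩
    simp
    done
  | refine ⟨-1, Or.inr rfl, ?_⟩
    simp [PauliX_mul_PauliY, PauliY_mul_PauliX, PauliY_mul_PauliZ, PauliZ_mul_PauliY,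
      PauliZ_mul_PauliX, PauliX_mul_PauliZ]

lemma PauliSet.exists_anticommute (hA : A ∈ PauliSet) (h1 : A ≠ 1) :
    ∃ B ∈ PauliSet, A * B = -(B * A) := by
  rcases hA with rfl | rfl | rfl | rfl
  · exact absurd rfl h1
  · exact ⟨PauliZ, by simp, by simp [PauliX_mul_PauliZ, PauliZ_mul_PauliX]⟩
  · exact ⟨PauliX, by simp, by simp [PauliX_mul_PauliY, PauliY_mul_PauliX]⟩
  · exact ⟨PauliX, by simp, by simp [PauliX_mul_PauliZ, PauliZ_mul_PauliX]⟩

lemma PauliSet.eq_one_or_eq_PauliX_or_anticommute (hA : A ∈ PauliSet) :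
    A = 1 ∨ A = PauliX ∨ A * PauliX = -(PauliX * A) := by
  rcases hA with rfl | rfl | rfl | rfl
  · simp
  · simp
  · simp [PauliX_mul_PauliY, PauliY_mul_PauliX]
  · simp [PauliX_mul_PauliZ, PauliZ_mul_PauliX]

end SingleQubit

section PString

variable {N : ℕ} {σ τ : Fin N → Matrix (Fin 2) (Fin 2) ℂ}

lemma PString_mul (σ τ : Fin N → Matrix (Fin 2) (Fin 2) ℂ) :
    PString σ * PString τ = PString fun i => σ i * τ i := by
  ext a b
  simp only [PString, Matrix.mul_apply, Matrix.of_apply, ← Finset.prod_mul_distrib,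
    Finset.prod_univ_sum, Fintype.piFinset_univ]

lemma PString_smul (c : Fin N → ℂ) (σ : Fin N → Matrix (Fin 2) (Fin 2) ℂ) :
    PString (fun i => c i • σ i) = (∏ i, c i) • PString σ := by
  ext a b
  simp [PString, Finset.prod_mul_distrib]

lemma PString_one : PString (1 : Fin N → Matrix (Fin 2) (Fin 2) ℂ) = 1 := by
  ext a b
  simp only [PString, Matrix.of_apply, Pi.one_apply, Matrix.one_apply]
  rw [Finset.prod_ite_zero]
  simp [funext_iff]

lemma PString_conjTranspose (σ : Fin N → Matrix (Fin 2) (Fin 2) ℂ) :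
    (PString σ)ᴴ = PString fun i => (σ i)ᴴ := by
  ext a b
  simp [PString, Matrix.conjTranspose_apply]

lemma PString_update_apply (σ : Fin N → Matrix (Fin 2) (Fin 2) ℂ) (i : Fin N)
    (A : Matrix (Fin 2) (Fin 2) ℂ) (a b : Fin N → Fin 2) :
    PString (Function.update σ i A) a b =
      A (a i) (b i) * ∏ j ∈ Finset.univ.erase i, σ j (a j) (b j) := by
  simp only [PString, Matrix.of_apply]
  rw [← Finset.mul_prod_erase _ _ (Finset.mem_univ i), Function.update_self]
  congr 1
  refine Finset.prod_congr rfl fun j hj => ?_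
  rw [Function.update_of_ne (Finset.ne_of_mem_erase hj)]

lemma PString_update_add (σ : Fin N → Matrix (Fin 2) (Fin 2) ℂ) (i : Fin N)
    (A B : Matrix (Fin 2) (Fin 2) ℂ) :
    PString (Function.update σ i (A + B)) =
      PString (Function.update σ i A) + PString (Function.update σ i B) := by
  ext a b
  simp only [Matrix.add_apply, PString_update_apply, add_mul]

lemma PString_update_smul (σ : Fin N → Matrix (Fin 2) (Fin 2) ℂ) (i : Fin N) (c : ℂ)
    (A : Matrix (Fin 2) (Fin 2) ℂ) :
    PString (Function.update σ i (c • A)) = c • PString (Function.update σ i A) := by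
  ext a b
  simp only [Matrix.smul_apply, PString_update_apply, smul_eq_mul, mul_assoc]

lemma PString_mul_comm_smul (c : Fin N → ℂ) (h : ∀ i, σ i * τ i = c i • (τ i * σ i)) :
    PString σ * PString τ = (∏ i, c i) • (PString τ * PString σ) := by
  rw [PString_mul, PString_mul, ← PString_smul]
  simp only [h]

lemma PString_commute (h : ∀ i, Commute (σ i) (τ i)) : Commute (PString σ) (PString τ) := by
  simpa [Commute, SemiconjBy] using
    PString_mul_comm_smul (σ := σ) (τ := τ) 1 fun i => by simpa using (h i).eq

lemma PString_anticommute (m : Fin N) (hm : σ m * τ m = -(τ m * σ m))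
    (h : ∀ i, i ≠ m → Commute (σ i) (τ i)) :
    PString σ * PString τ = -(PString τ * PString σ) := by
  have key := PString_mul_comm_smul (σ := σ) (τ := τ) (fun i => if i = m then -1 else 1)
    fun i => by
      by_cases hi : i = m
      · subst hi; simpa using hm
      · simpa [hi] using (h i hi).eq
  simpa using key

lemma PString_mul_self (h : ∀ i, σ i ∈ PauliSet) : PString σ * PString σ = 1 := by
  rw [PString_mul, ← PString_one]
  exact congrArg PString (funext fun i => PauliSet.mul_self (h i))

lemma PString_isHermitian (h : ∀ i, σ i ∈ PauliSet) : (PString σ).IsHermitian := by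
  rw [Matrix.IsHermitian, PString_conjTranspose]
  exact congrArg PString (funext fun i => PauliSet.conjTranspose_eq (h i))

lemma update_mem_PauliSet (h : ∀ i, σ i ∈ PauliSet) (m : Fin N)
    {A : Matrix (Fin 2) (Fin 2) ℂ} (hA : A ∈ PauliSet) (i : Fin N) :
    Function.update σ m A i ∈ PauliSet := by
  by_cases hi : i = m
  · subst hi; simpa using hA
  · simpa [hi] using h i

lemma one_mem_PauliSet (i : Fin N) :
    (1 : Fin N → Matrix (Fin 2) (Fin 2) ℂ) i ∈ PauliSet := Or.inl rfl

/-- The operator `A` acting on qubit `i`. -/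
noncomputable def singleSite (i : Fin N) (A : Matrix (Fin 2) (Fin 2) ℂ) :
    Matrix (Fin N → Fin 2) (Fin N → Fin 2) ℂ :=
  PString (Function.update 1 i A)

lemma half_smul_one_add_singleSite (i : Fin N) (A : Matrix (Fin 2) (Fin 2) ℂ) :
    (2⁻¹ : ℂ) • (1 + singleSite i A) = singleSite i ((2⁻¹ : ℂ) • (1 + A)) := by
  have h1 : Function.update (1 : Fin N → Matrix (Fin 2) (Fin 2) ℂ) i 1 = 1 :=
    Function.update_eq_self i 1
  rw [singleSite, singleSite, PString_update_smul, PString_update_add, h1, PString_one]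

lemma prod_ofFn_singleSite (A : Matrix (Fin 2) (Fin 2) ℂ) :
    ∀ (K : ℕ) (hK : K ≤ N),
      (List.ofFn fun k : Fin K => singleSite (Fin.castLE hK k) A).prod =
        PString fun i : Fin N => if (i : ℕ) < K then A else 1
  | 0, _ => by simpa [Pi.one_def] using (PString_one (N := N)).symm
  | K + 1, hK => by
    rw [List.ofFn_succ', List.concat_eq_append, List.prod_append, List.prod_singleton]
    have ih := prod_ofFn_singleSite A K (Nat.le_of_succ_le hK)
    have hc : ∀ k : Fin K, Fin.castLE hK k.castSucc = Fin.castLE (Nat.le_of_succ_le hK) k :=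
      fun k => rfl
    simp only [hc]
    rw [ih, singleSite, PString_mul]
    refine congrArg PString (funext fun i => ?_)
    by_cases hi : i = Fin.castLE hK (Fin.last K)
    · subst hi; simp
    · have hne : (i : ℕ) ≠ K := fun h => hi (Fin.ext h)
      rw [Function.update_of_ne hi, Pi.one_apply, mul_one]
      exact if_congr (by omega) rfl rfl

end PString

section SignedPauli

variable {N : ℕ} {M P Q R U V : Matrix (Fin N → Fin 2) (Fin N → Fin 2) ℂ}
  {σ : Fin N → Matrix (Fin 2) (Fin 2) ℂ}

/-- A scalar multiple of a Pauli string. -/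
def IsPauliMultiple (M : Matrix (Fin N → Fin 2) (Fin N → Fin 2) ℂ) : Prop :=
  ∃ (c : ℂ) (σ : Fin N → Matrix (Fin 2) (Fin 2) ℂ), (∀ i, σ i ∈ PauliSet) ∧ M = c • PString σ

lemma IsPauliMultiple.smul (h : IsPauliMultiple M) (c : ℂ) : IsPauliMultiple (c • M) := by
  obtain ⟨d, σ, hσ, rfl⟩ := h
  exact ⟨c * d, σ, hσ, smul_smul _ _ _⟩

lemma IsPauliMultiple.neg (h : IsPauliMultiple M) : IsPauliMultiple (-M) := by
  simpa using h.smul (-1)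

lemma IsPauliMultiple.mul (hP : IsPauliMultiple P) (hQ : IsPauliMultiple Q) :
    IsPauliMultiple (P * Q) := by
  obtain ⟨c, σ, hσ, rfl⟩ := hP
  obtain ⟨d, τ, hτ, rfl⟩ := hQ
  choose e υ hυ he using fun i => PauliSet.exists_mul_eq_smul (hσ i) (hτ i)
  refine ⟨c * d * ∏ i, e i, υ, hυ, ?_⟩
  rw [smul_mul_smul_comm, PString_mul, mul_smul (c * d), ← PString_smul]
  simp only [he]

lemma isSignedPauli_PString (hσ : ∀ i, σ i ∈ PauliSet) : IsSignedPauli (PString σ) :=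
  ⟨1, σ, Or.inl rfl, hσ, (one_smul _ _).symm⟩

lemma isSignedPauli_singleSite (i : Fin N) {A : Matrix (Fin 2) (Fin 2) ℂ} (hA : A ∈ PauliSet) :
    IsSignedPauli (singleSite i A) :=
  isSignedPauli_PString (update_mem_PauliSet one_mem_PauliSet i hA)

lemma IsSignedPauli.isPauliMultiple (h : IsSignedPauli M) : IsPauliMultiple M := by
  obtain ⟨s, σ, -, hσ, rfl⟩ := h
  exact ⟨s, σ, hσ, rfl⟩

lemma IsSignedPauli.mul_self (h : IsSignedPauli M) : M * M = 1 := by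
  obtain ⟨s, σ, rfl | rfl, hσ, rfl⟩ := h <;> simp [PString_mul_self hσ]

lemma IsSignedPauli.isHermitian (h : IsSignedPauli M) : M.IsHermitian := by
  obtain ⟨s, σ, rfl | rfl, hσ, rfl⟩ := h <;>
    simp [Matrix.IsHermitian, (PString_isHermitian hσ).eq]

lemma IsPauliMultiple.isSignedPauli (h : IsPauliMultiple M) (hM : M * M = 1) :
    IsSignedPauli M := by
  obtain ⟨c, σ, hσ, rfl⟩ := h
  refine ⟨c, σ, ?_, hσ, rfl⟩
  rw [smul_mul_smul_comm, PString_mul_self hσ] at hM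
  have h1 := congrFun (congrFun hM 0) 0
  simp only [Matrix.smul_apply, Matrix.one_apply_eq, smul_eq_mul, mul_one] at h1
  exact mul_self_eq_one_iff.mp h1

lemma IsSignedPauli.commute_or_anticommute (hP : IsSignedPauli P) (hQ : IsSignedPauli Q) :
    P * Q = Q * P ∨ P * Q = -(Q * P) := by
  obtain ⟨s, σ, -, hσ, rfl⟩ := hP
  obtain ⟨t, τ, -, hτ, rfl⟩ := hQ
  choose c hc hcomm using fun i =>
    PauliSet.commute_or_anticommute (hσ i) (hτ i)
  have key := PString_mul_comm_smul c hcomm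
  have hprod : (∏ i, c i) = 1 ∨ (∏ i, c i) = -1 :=
    Finset.prod_induction c (fun x => x = 1 ∨ x = -1)
      (by rintro a b (rfl | rfl) (rfl | rfl) <;> simp) (Or.inl rfl) fun i _ => hc i
  rw [smul_mul_smul_comm, smul_mul_smul_comm, key, mul_comm s t]
  rcases hprod with h | h <;> simp [h]

lemma IsSignedPauli.not_commute_of_anticommute (hP : IsSignedPauli P) (hQ : IsSignedPauli Q)
    (h : P * Q = -(Q * P)) : P * Q ≠ Q * P := by
  intro h'
  have h0 : Q * P = 0 := by
    ext a b
    exact self_eq_neg.mp (congrFun (congrFun (h'.symm.trans h) a) b)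
  have h1 : Q * (Q * P) * P = 1 := by
    rw [← mul_assoc, hQ.mul_self, one_mul, hP.mul_self]
  rw [h0, mul_zero, zero_mul] at h1
  exact zero_ne_one h1

/-- A unitary that conjugates signed Pauli strings to signed Pauli strings. -/
def IsClifford (U : Matrix (Fin N → Fin 2) (Fin N → Fin 2) ℂ) : Prop :=
  Uᴴ * U = 1 ∧ ∀ M, IsSignedPauli M → IsSignedPauli (U * M * Uᴴ)

lemma isClifford_one : IsClifford (1 : Matrix (Fin N → Fin 2) (Fin N → Fin 2) ℂ) :=
  ⟨by simp, fun M hM => by simpa using hM⟩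

lemma IsClifford.mul_conjTranspose (h : IsClifford U) : U * Uᴴ = 1 :=
  mul_eq_one_comm.mp h.1

lemma IsClifford.mul (hU : IsClifford U) (hV : IsClifford V) : IsClifford (U * V) := by
  refine ⟨?_, fun M hM => ?_⟩
  · rw [conjTranspose_mul, mul_assoc, ← mul_assoc Uᴴ, hU.1, one_mul, hV.1]
  · have := hU.2 _ (hV.2 M hM)
    simpa only [conjTranspose_mul, mul_assoc] using this

lemma IsClifford.conj_mul (hU : IsClifford U) (P Q : Matrix (Fin N → Fin 2) (Fin N → Fin 2) ℂ) :
    U * (P * Q) * Uᴴ = (U * P * Uᴴ) * (U * Q * Uᴴ) := by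
  simp only [mul_assoc]
  rw [← mul_assoc Uᴴ U, hU.1, one_mul]

lemma IsClifford.eq_of_conj_eq_smul_one (hU : IsClifford U) {c : ℂ} (h : U * P * Uᴴ = c • 1) :
    P = c • 1 := by
  calc P = Uᴴ * U * P * (Uᴴ * U) := by rw [hU.1, one_mul, mul_one]
    _ = Uᴴ * (U * P * Uᴴ) * U := by simp only [mul_assoc]
    _ = c • 1 := by rw [h]; simp [hU.1]

lemma IsClifford.conj_eq_of_commute (hU : IsClifford U) (h : Commute U P) : U * P * Uᴴ = P := by
  rw [h.eq, mul_assoc, hU.mul_conjTranspose, mul_one]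

/-- Two anticommuting signed Pauli strings are exchanged by a Clifford unitary that commutes with
everything commuting with both of them, namely `(P + Q) / √2`. -/
lemma exists_isClifford_swap (hP : IsSignedPauli P) (hQ : IsSignedPauli Q)
    (h : P * Q = -(Q * P)) :
    ∃ U, IsClifford U ∧ U * P * Uᴴ = Q ∧ ∀ M, Commute P M → Commute Q M → Commute U M := by
  set r : ℂ := Complex.ofReal (Real.sqrt 2)⁻¹ with hr
  have hrr : r * r = 2⁻¹ := by
    rw [hr, ← Complex.ofReal_mul, ← mul_inv, Real.mul_self_sqrt (by norm_num)]
    norm_num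
  have hstar : (r • (P + Q))ᴴ = r • (P + Q) := by
    rw [conjTranspose_smul, conjTranspose_add, hP.isHermitian.eq, hQ.isHermitian.eq, hr]
    simp
  have hconj : ∀ M, r • (P + Q) * M * (r • (P + Q)) =
      (2⁻¹ : ℂ) • ((P + Q) * M * (P + Q)) := fun M => by
    rw [smul_mul_assoc, smul_mul_smul_comm, hrr]
  have hsq : (P + Q) * (P + Q) = (2 : ℂ) • 1 := by
    rw [add_mul, mul_add, mul_add, hP.mul_self, hQ.mul_self, h, two_smul]
    abel
  have hU : r • (P + Q) * r • (P + Q) = 1 := by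
    rw [smul_mul_smul_comm, hrr, hsq, smul_smul]
    norm_num
  refine ⟨r • (P + Q), ⟨by rw [hstar, hU], fun R hR => ?_⟩, ?_, fun M h₁ h₂ =>
    (h₁.add_left h₂).smul_left r⟩
  · rw [hstar]
    have hRR : (r • (P + Q) * R * r • (P + Q)) * (r • (P + Q) * R * r • (P + Q)) = 1 := by
      set W := r • (P + Q)
      calc W * R * W * (W * R * W) = W * R * (W * W) * R * W := by simp only [mul_assoc]
        _ = W * (R * R) * W := by rw [hU, mul_one]; simp only [mul_assoc]
        _ = 1 := by rw [hR.mul_self, mul_one, hU]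
    refine IsPauliMultiple.isSignedPauli ?_ hRR
    have hPQR : IsPauliMultiple (P * Q * R) :=
      (hP.isPauliMultiple.mul hQ.isPauliMultiple).mul hR.isPauliMultiple
    have hsub : (P + Q) * (P - Q) = -((2 : ℂ) • (P * Q)) := by
      rw [add_mul, mul_sub, mul_sub, hP.mul_self, hQ.mul_self, two_smul, h]
      abel
    rw [hconj]
    rcases hR.commute_or_anticommute hP with hRP | hRP <;>
      rcases hR.commute_or_anticommute hQ with hRQ | hRQ
    · have : (P + Q) * R * (P + Q) = (2 : ℂ) • R := by
        rw [mul_assoc, mul_add R, hRP, hRQ, ← add_mul, ← mul_assoc, hsq, smul_mul_assoc, one_mul]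
      rw [this]
      exact (hR.isPauliMultiple.smul _).smul _
    · have : (P + Q) * R * (P + Q) = -((2 : ℂ) • (P * Q * R)) := by
        rw [mul_assoc, mul_add R, hRP, hRQ, ← sub_eq_add_neg, ← sub_mul, ← mul_assoc, hsub,
          neg_mul, smul_mul_assoc]
      rw [this]
      exact (hPQR.smul _).neg.smul _
    · have : (P + Q) * R * (P + Q) = (2 : ℂ) • (P * Q * R) := by
        rw [mul_assoc, mul_add R, hRP, hRQ, neg_add_eq_sub, ← sub_mul, ← neg_sub P Q, neg_mul,
          mul_neg, ← mul_assoc, hsub, neg_mul, neg_neg, smul_mul_assoc]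
      rw [this]
      exact (hPQR.smul _).smul _
    · have : (P + Q) * R * (P + Q) = -((2 : ℂ) • R) := by
        rw [mul_assoc, mul_add R, hRP, hRQ, ← neg_add, ← add_mul, mul_neg, ← mul_assoc, hsq,
          smul_mul_assoc, one_mul]
      rw [this]
      exact (hR.isPauliMultiple.smul _).neg.smul _
  · rw [hstar, hconj]
    have : (P + Q) * P * (P + Q) = (2 : ℂ) • Q := by
      have hQP : Q * P = -(P * Q) := by rw [h, neg_neg]
      rw [add_mul, hP.mul_self, hQP, ← sub_eq_add_neg, sub_mul, one_mul, mul_add, mul_assoc P Q Q,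
        hQ.mul_self, mul_one, mul_assoc P Q P, hQP, mul_neg, ← mul_assoc, hP.mul_self, one_mul,
        two_smul]
      abel
    rw [this, smul_smul]
    norm_num

lemma eq_one_or_eq_PauliX_of_commute (hσ : ∀ i, σ i ∈ PauliSet) {i : Fin N}
    (h : Commute (PString σ) (singleSite i PauliX)) : σ i = 1 ∨ σ i = PauliX := by
  rcases PauliSet.eq_one_or_eq_PauliX_or_anticommute (hσ i) with h1 | h1 | h1
  · exact Or.inl h1
  · exact Or.inr h1
  · refine absurd h.eq ((isSignedPauli_PString hσ).not_commute_of_anticommute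
      (isSignedPauli_singleSite i (by simp)) (PString_anticommute i (by simpa using h1) ?_))
    intro j hj
    simp [hj]

lemma exists_anticommuting_string (hσ : ∀ i, σ i ∈ PauliSet) {m j : Fin N} (hmj : m ≤ j)
    (hj : σ j ≠ 1) (hm : σ m = 1 ∨ σ m = PauliX) :
    ∃ R, IsSignedPauli R ∧ PString σ * R = -(R * PString σ) ∧
      R * singleSite m PauliX = -(singleSite m PauliX * R) ∧
      ∀ i < m, Commute R (singleSite i PauliX) := by
  have hZX : PauliZ * PauliX = -(PauliX * PauliZ) := by
    simp [PauliX_mul_PauliZ, PauliZ_mul_PauliX]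
  have hXZ : PauliX * PauliZ = -(PauliZ * PauliX) := by rw [hZX, neg_neg]
  rcases hm with hm | hm
  · obtain ⟨B, hB, hanti⟩ := PauliSet.exists_anticommute (hσ j) hj
    have hne : m ≠ j := by rintro rfl; exact hj hm
    refine ⟨PString (Function.update (Function.update 1 m PauliZ) j B),
      isSignedPauli_PString (update_mem_PauliSet
        (update_mem_PauliSet one_mem_PauliSet m (by simp)) j hB),
      PString_anticommute j (by simpa using hanti) fun i hi => ?_,
      PString_anticommute m (by simpa [hne] using hZX) fun i hi => by simp [hi],
      fun i hi => PString_commute fun l => ?_⟩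
    · by_cases him : i = m
      · subst him; simp [hm]
      · simp [hi, him]
    · by_cases hl : l = i
      · subst hl; simp [hi.ne, (hi.trans_le hmj).ne]
      · simp [hl]
  · refine ⟨singleSite m PauliZ, isSignedPauli_singleSite m (by simp),
      PString_anticommute m (by simpa [hm] using hXZ) fun i hi => by simp [hi],
      PString_anticommute m (by simpa using hZX) fun i hi => by simp [hi],
      fun i hi => PString_commute fun l => ?_⟩
    by_cases hl : l = i
    · subst hl; simp [hi.ne]
    · simp [hl]

lemma exists_isClifford_conj_eq_singleSite (hσ : ∀ i, σ i ∈ PauliSet) {s : ℂ}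
    (hs : s = 1 ∨ s = -1) {m j : Fin N} (hmj : m ≤ j) (hj : σ j ≠ 1)
    (hcomm : ∀ i < m, Commute (PString σ) (singleSite i PauliX)) :
    ∃ V, IsClifford V ∧ V * (s • PString σ) * Vᴴ = singleSite m PauliX ∧
      ∀ i < m, Commute V (singleSite i PauliX) := by
  have hP : IsSignedPauli (s • PString σ) := ⟨s, σ, hs, hσ, rfl⟩
  have hX : IsSignedPauli (singleSite m PauliX) := isSignedPauli_singleSite m (by simp)
  have hXX : ∀ i, Commute (singleSite m PauliX) (singleSite i PauliX) := fun i =>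
    PString_commute fun l => by
      simp only [Function.update_apply]
      split_ifs <;> simp
  have hPX : ∀ i < m, Commute (s • PString σ) (singleSite i PauliX) := fun i hi =>
    (hcomm i hi).smul_left s
  rcases hP.commute_or_anticommute hX with h | h
  · have h' : Commute (PString σ) (singleSite m PauliX) := by
      have := Commute.smul_left (show Commute (s • PString σ) (singleSite m PauliX) from h) s
      rcases hs with rfl | rfl <;> simpa using this
    obtain ⟨R, hR, hPR, hRX, hRc⟩ :=
      exists_anticommuting_string hσ hmj hj (eq_one_or_eq_PauliX_of_commute hσ h')
    obtain ⟨U, hU, hUP, hUc⟩ := exists_isClifford_swap hP hR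
      (by rw [smul_mul_assoc, hPR, mul_smul_comm, smul_neg])
    obtain ⟨V, hV, hVR, hVc⟩ := exists_isClifford_swap hR hX hRX
    refine ⟨V * U, hV.mul hU, ?_, fun i hi => (hVc _ (hRc i hi) (hXX i)).mul_left
      (hUc _ (hPX i hi) (hRc i hi))⟩
    rw [conjTranspose_mul, ← hVR, ← hUP]
    simp only [mul_assoc]
  · obtain ⟨U, hU, hUP, hUc⟩ := exists_isClifford_swap hP hX h
    exact ⟨U, hU, hUP, fun i hi => hUc _ (hPX i hi) (hXX i)⟩

end SignedPauli

section Generators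

variable {N K : ℕ} {g : Fin K → Matrix (Fin N → Fin 2) (Fin N → Fin 2) ℂ}
  {U : Matrix (Fin N → Fin 2) (Fin N → Fin 2) ℂ}

lemma IsClifford.conj_noncommProd (hU : IsClifford U) (T : Finset (Fin K))
    (hcomm : (T : Set (Fin K)).Pairwise (Function.onFun Commute g)) (hT : ∀ k ∈ T, ∃ i : Fin N, (i : ℕ) = k ∧
      U * g k * Uᴴ = singleSite i PauliX) :
    U * T.noncommProd g hcomm * Uᴴ =
      PString fun i : Fin N => if ∃ k ∈ T, (k : ℕ) = i then PauliX else 1 := by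
  induction T using Finset.induction_on with
  | empty => simpa [hU.mul_conjTranspose, Pi.one_def] using (PString_one (N := N)).symm
  | insert a T ha ih =>
    obtain ⟨i, hia, hi⟩ := hT a (Finset.mem_insert_self a T)
    rw [Finset.noncommProd_insert_of_notMem _ _ _ _ ha, hU.conj_mul, hi,
      ih _ fun k hk => hT k (Finset.mem_insert_of_mem hk), singleSite, PString_mul]
    refine congrArg PString (funext fun l => ?_)
    by_cases hl : l = i
    · subst hl
      have hno : ¬ ∃ k ∈ T, (k : ℕ) = l := by
        rintro ⟨k, hk, hkl⟩
        exact ha ((Fin.ext (hkl.trans hia) : k = a) ▸ hk)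
      rw [if_neg hno, if_pos ⟨a, Finset.mem_insert_self a T, hia.symm⟩, Function.update_self,
        mul_one]
    · have hal : (a : ℕ) ≠ l := fun h => hl (Fin.ext (h.symm.trans hia.symm))
      simp [hl, hal]

lemma exists_isClifford_conj_generators (hpauli : ∀ k, IsSignedPauli (g k))
    (hcomm : ∀ k l, Commute (g k) (g l))
    (hindep : ∀ T : Finset (Fin K), T.Nonempty →
      (T.noncommProd g fun a _ b _ _ => hcomm a b) ≠ 1 ∧
      (T.noncommProd g fun a _ b _ _ => hcomm a b) ≠ -1) :
    ∀ n ≤ K, ∃ U, IsClifford U ∧ ∀ k : Fin K, (k : ℕ) < n →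
      ∃ i : Fin N, (i : ℕ) = k ∧ U * g k * Uᴴ = singleSite i PauliX
  | 0, _ => ⟨1, isClifford_one, fun _ hk => absurd hk (Nat.not_lt_zero _)⟩
  | n + 1, hn => by
    obtain ⟨U, hU, hUg⟩ :=
      exists_isClifford_conj_generators hpauli hcomm hindep n (Nat.le_of_succ_le hn)
    let q : Fin K := ⟨n, hn⟩
    obtain ⟨s, σ, hs, hσ, hq⟩ := hU.2 _ (hpauli q)
    have hσX : ∀ i : Fin N, (i : ℕ) < n → Commute (PString σ) (singleSite i PauliX) := by
      intro i hi
      obtain ⟨i', hi', hX⟩ := hUg ⟨i, hi.trans hn⟩ hi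
      obtain rfl : i' = i := Fin.ext hi'
      have h : Commute (s • PString σ) (singleSite i' PauliX) := by
        rw [← hX, ← hq, Commute, SemiconjBy, ← hU.conj_mul, ← hU.conj_mul, (hcomm _ _).eq]
      have h' := h.smul_left s
      rcases hs with rfl | rfl <;> simpa using h'
    obtain ⟨j, hnj, hj⟩ : ∃ j : Fin N, n ≤ (j : ℕ) ∧ σ j ≠ 1 := by
      by_contra! hone
      let T : Finset (Fin K) := {k | (k : ℕ) < n ∧ ∃ i : Fin N, (i : ℕ) = k ∧ σ i ≠ 1}
      have hqT : q ∉ T := by simp [T, q]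
      have hTσ := hU.conj_noncommProd T (fun a _ b _ _ => hcomm a b) fun k hk =>
        hUg k (Finset.mem_filter.mp hk).2.1
      have hfun : (fun i : Fin N => if ∃ k ∈ T, (k : ℕ) = i then PauliX else 1) = σ := by
        funext i
        by_cases hi : σ i = 1
        · rw [hi, if_neg]
          rintro ⟨k, hk, hki⟩
          obtain ⟨i', hi', hne⟩ := (Finset.mem_filter.mp hk).2.2
          exact hne ((Fin.ext (hi'.trans hki) : i' = i) ▸ hi)
        · have hin : (i : ℕ) < n := not_le.mp fun h => hi (hone i h)
          rw [if_pos ⟨⟨i, hin.trans hn⟩, by simpa [T, hin] using ⟨i, rfl, hi⟩, rfl⟩]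
          exact ((eq_one_or_eq_PauliX_of_commute hσ (hσX i hin)).resolve_left hi).symm
      have hprod : (insert q T).noncommProd g (fun a _ b _ _ => hcomm a b) = s • 1 := by
        refine (Finset.noncommProd_insert_of_notMem T q g (fun a _ b _ _ => hcomm a b) hqT).trans
          (hU.eq_of_conj_eq_smul_one ?_)
        rw [hU.conj_mul, hTσ, hfun, hq,
          smul_mul_assoc, PString_mul_self hσ]
      have hcontra := hindep (insert q T) (Finset.insert_nonempty q T)
      rw [hprod] at hcontra
      rcases hs with rfl | rfl
      · exact hcontra.1 (one_smul _ _)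
      · exact hcontra.2 (by simp)
    let m : Fin N := ⟨n, hnj.trans_lt j.2⟩
    obtain ⟨V, hV, hVσ, hVX⟩ :=
      exists_isClifford_conj_eq_singleSite hσ hs (m := m) hnj hj fun i hi => hσX i hi
    have hassoc : ∀ M, V * U * M * (V * U)ᴴ = V * (U * M * Uᴴ) * Vᴴ := fun M => by
      simp only [conjTranspose_mul, mul_assoc]
    refine ⟨V * U, hV.mul hU, fun k hk => ?_⟩
    rw [hassoc]
    rcases Nat.lt_succ_iff_lt_or_eq.mp hk with hk | hk
    · obtain ⟨i, hik, hi⟩ := hUg k hk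
      exact ⟨i, hik, by rw [hi, hV.conj_eq_of_commute (hVX i (Fin.lt_def.mpr (hik ▸ hk)))]⟩
    · obtain rfl : k = q := Fin.ext hk
      exact ⟨m, rfl, by rw [hq, hVσ]⟩

lemma IsClifford.conj_list_prod (hU : IsClifford U)
    (L : List (Matrix (Fin N → Fin 2) (Fin N → Fin 2) ℂ)) :
    U * L.prod * Uᴴ = (L.map fun M => U * M * Uᴴ).prod := by
  induction L with
  | nil => simp [hU.mul_conjTranspose]
  | cons M L ih => rw [List.prod_cons, hU.conj_mul, ih, List.map_cons, List.prod_cons]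

end Generators

/-- **Single-party normal form of a mixed stabiliser state.** Every mixed stabiliser
state with `K` independent commuting Hermitian signed Pauli string generators is
mapped by some Clifford unitary `U` (a unitary conjugating Pauli strings to signed
Pauli strings) to `((I₂ + X)/2)^{⊗K} ⊗ (I₂/2)^{⊗(N-K)}`. -/
theorem stmt19 (N K : ℕ)
    (g : Fin K → Matrix (Fin N → Fin 2) (Fin N → Fin 2) ℂ)
    (hherm : ∀ k, (g k).IsHermitian)
    (hpauli : ∀ k, IsSignedPauli (g k))
    (hcomm : ∀ k l, Commute (g k) (g l))
    (hindep : ∀ T : Finset (Fin K), T.Nonempty →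
      (T.noncommProd g fun a _ b _ _ => hcomm a b) ≠ 1 ∧
      (T.noncommProd g fun a _ b _ _ => hcomm a b) ≠ -1)
    (ρ : Matrix (Fin N → Fin 2) (Fin N → Fin 2) ℂ)
    (hρ : ρ = ((2 : ℂ) ^ (N - K))⁻¹ •
      (List.ofFn fun k => (2⁻¹ : ℂ) • (1 + g k)).prod) :
    ∃ U : Matrix (Fin N → Fin 2) (Fin N → Fin 2) ℂ,
      U ∈ Matrix.unitaryGroup (Fin N → Fin 2) ℂ ∧
      (∀ σ : Fin N → Matrix (Fin 2) (Fin 2) ℂ,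
        (∀ i, σ i ∈ ({1, PauliX, PauliY, PauliZ} : Set (Matrix (Fin 2) (Fin 2) ℂ))) →
        IsSignedPauli (U * PString σ * Uᴴ)) ∧
      U * ρ * Uᴴ = PString (fun i =>
        if (i : ℕ) < K then (2⁻¹ : ℂ) • (1 + PauliX)
        else (2⁻¹ : ℂ) • (1 : Matrix (Fin 2) (Fin 2) ℂ)) := by
  obtain ⟨U, hU, hUg⟩ := exists_isClifford_conj_generators hpauli hcomm hindep K le_rfl
  have hKN : K ≤ N := by
    rcases K with _ | K
    · exact Nat.zero_le N
    · obtain ⟨i, hi, -⟩ := hUg (Fin.last K) (Fin.last K).2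
      have h := i.2
      rw [hi, Fin.val_last] at h
      exact h
  refine ⟨U, Matrix.mem_unitaryGroup_iff.mpr hU.mul_conjTranspose,
    fun σ hσ => hU.2 _ (isSignedPauli_PString hσ), ?_⟩
  have hfactor : ∀ k : Fin K, U * ((2⁻¹ : ℂ) • (1 + g k)) * Uᴴ =
      singleSite (Fin.castLE hKN k) ((2⁻¹ : ℂ) • (1 + PauliX)) := fun k => by
    obtain ⟨i, hik, hi⟩ := hUg k k.2
    obtain rfl : i = Fin.castLE hKN k := Fin.ext hik
    rw [← half_smul_one_add_singleSite, ← hi, mul_smul_comm, smul_mul_assoc, mul_add, add_mul,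
      mul_one, hU.mul_conjTranspose]
  have hcoeff : ((2 : ℂ) ^ (N - K))⁻¹ = ∏ i : Fin N, if (i : ℕ) < K then (1 : ℂ) else 2⁻¹ := by
    rw [Finset.prod_ite, Finset.prod_const_one, one_mul, Finset.prod_const, inv_pow]
    congr 2
    have hcard := Finset.card_filter_add_card_filter_not (s := (Finset.univ : Finset (Fin N)))
      fun i : Fin N => (i : ℕ) < K
    rw [Fin.card_filter_val_lt, Finset.card_univ, Fintype.card_fin] at hcard
    omega
  rw [hρ, mul_smul_comm, smul_mul_assoc, hU.conj_list_prod, List.map_ofFn]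
  simp only [Function.comp_def, hfactor]
  rw [prod_ofFn_singleSite, hcoeff, ← PString_smul]
  refine congrArg PString (funext fun i => ?_)
  by_cases hi : (i : ℕ) < K <;> simp [hi]
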